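/- There exist origin-symmetric convex bodies K and L in R^3, each containing the origin in its interior, such that σ({θ ∈ S^2 : ρ_K(θ) ≥ t}) = σ({θ ∈ S^2 : ρ_L(θ) ≥ t}) for all t ≥ 0, but S_K(t₀) ≠ S_L(t₀) for some t₀ ≥ 0. That is, convex bodies with the same distribution of radial functions may have different distributions of the areas of their central sections. -/

import Mathlib

open MeasureTheory Metric Set
open scoped RealInnerProductSpace ENNReal NNReal

noncomputable section

/-- Euclidean space `ℝ^n`. -/
abbrev Euc (n : ℕ) := EuclideanSpace ℝ (Fin n)

/-- A convex body: a compact convex set with nonempty interior. -/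
def IsConvexBody {n : ℕ} (K : Set (Euc n)) : Prop :=
  Convex ℝ K ∧ IsCompact K ∧ (interior K).Nonempty

/-- The Haar (rotation invariant) probability measure of a set of directions on the
unit sphere `S^{n-1}`, realized as normalized `(n-1)`-dimensional Hausdorff measure. -/
def sphHaar (n : ℕ) (A : Set (Euc n)) : ℝ≥0∞ :=
  μH[(n : ℝ) - 1] (A ∩ sphere (0 : Euc n) 1) / μH[(n : ℝ) - 1] (sphere (0 : Euc n) 1)

/-- `|K ∩ θ^⊥|`: the `(n-1)`-dimensional Hausdorff measure of the central section of `K`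
perpendicular to `θ`. -/
def sectionVol (n : ℕ) (K : Set (Euc n)) (θ : Euc n) : ℝ≥0∞ :=
  μH[(n : ℝ) - 1] (K ∩ {x : Euc n | ⟪x, θ⟫ = 0})

/-- `S_K(t)`: distribution function of the areas of central hyperplane sections. -/
def Sdist (n : ℕ) (K : Set (Euc n)) (t : ℝ) : ℝ≥0∞ :=
  sphHaar n {θ : Euc n | ENNReal.ofReal t ≤ sectionVol n K θ}

/-- `|K | θ^⊥|`: the `(n-1)`-dimensional Hausdorff measure of the orthogonal projection
of `K` onto the hyperplane `θ^⊥` (for a unit vector `θ`). -/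
def projVol (n : ℕ) (K : Set (Euc n)) (θ : Euc n) : ℝ≥0∞ :=
  μH[(n : ℝ) - 1] ((fun x => x - ⟪x, θ⟫ • θ) '' K)

/-- `Π_K(t)`: distribution function of the volumes of hyperplane projections. -/
def PiDist (n : ℕ) (K : Set (Euc n)) (t : ℝ) : ℝ≥0∞ :=
  sphHaar n {θ : Euc n | ENNReal.ofReal t ≤ projVol n K θ}

/-- The radial function `ρ_K(θ) = max {a ≥ 0 : a • θ ∈ K}`. -/
def radial {n : ℕ} (K : Set (Euc n)) (θ : Euc n) : ℝ :=
  sSup {a : ℝ | 0 ≤ a ∧ a • θ ∈ K}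

/-- The support function `h_K(θ) = sup_{y ∈ K} ⟨θ, y⟩`. -/
def suppFn {n : ℕ} (K : Set (Euc n)) (θ : Euc n) : ℝ :=
  sSup ((fun y => ⟪θ, y⟫) '' K)

/-- The polar body `K° = {x : ⟨x, y⟩ ≤ 1 for all y ∈ K}`. -/
def polarBody {n : ℕ} (K : Set (Euc n)) : Set (Euc n) :=
  {x | ∀ y ∈ K, ⟪x, y⟫ ≤ 1}

/-! ### Hausdorff measure in dimension two -/

theorem isAddHaarMeasure_hausdorffMeasure_two {E : Type*} [NormedAddCommGroup E]
    [NormedSpace ℝ E] [FiniteDimensional ℝ E] [MeasurableSpace E] [BorelSpace E]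
    (h : Module.finrank ℝ E = 2) : (μH[2] : Measure E).IsAddHaarMeasure := by
  have := isAddHaarMeasure_hausdorffMeasure (E := E)
  rw [h] at this
  exact_mod_cast this

instance : (μH[2] : Measure (Euc 2)).IsAddHaarMeasure :=
  isAddHaarMeasure_hausdorffMeasure_two (by simp)

instance : (μH[2] : Measure (ℝ × ℝ)).IsAddHaarMeasure :=
  isAddHaarMeasure_hausdorffMeasure_two (by simp)

/-- Spherical coordinates on the unit sphere of `ℝ³`. -/
def sphericalCoord (p : ℝ × ℝ) : Euc 3 :=
  !₂[Real.sin p.1 * Real.cos p.2, Real.sin p.1 * Real.sin p.2, Real.cos p.1]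

theorem contDiff_sphericalCoord : ContDiff ℝ 1 sphericalCoord := by
  rw [contDiff_euclidean]
  intro i
  fin_cases i <;> simp [sphericalCoord] <;> fun_prop

theorem sum_sq_of_mem_sphere {θ : Euc 3} (h : ‖θ‖ = 1) : θ 0 ^ 2 + θ 1 ^ 2 + θ 2 ^ 2 = 1 := by
  have := EuclideanSpace.norm_sq_eq θ
  rw [h, Fin.sum_univ_three] at this
  simp only [Real.norm_eq_abs, sq_abs] at this
  linarith

theorem sphere_subset_image_sphericalCoord :
    sphere (0 : Euc 3) 1 ⊆ sphericalCoord '' (Icc 0 Real.pi ×ˢ Icc (-Real.pi) Real.pi) := by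
  intro θ hθ
  have hs := sum_sq_of_mem_sphere (mem_sphere_zero_iff_norm.1 hθ)
  have hz : -1 ≤ θ 2 ∧ θ 2 ≤ 1 := abs_le.1 (by
    rw [← sq_le_one_iff_abs_le_one]; nlinarith [sq_nonneg (θ 0), sq_nonneg (θ 1)])
  set w : ℂ := ⟨θ 0, θ 1⟩ with hw
  have hnorm : Real.sin (Real.arccos (θ 2)) = ‖w‖ := by
    rw [Real.sin_arccos, Complex.norm_def, Complex.normSq_apply]
    congr 1
    simp only [hw]
    linarith
  refine ⟨(Real.arccos (θ 2), w.arg), ⟨⟨Real.arccos_nonneg _, Real.arccos_le_pi _⟩,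
    (Complex.neg_pi_lt_arg w).le, Complex.arg_le_pi w⟩, ?_⟩
  ext i
  fin_cases i
  · simp [sphericalCoord, hnorm, Complex.norm_mul_cos_arg, hw]
  · simp [sphericalCoord, hnorm, Complex.norm_mul_sin_arg, hw]
  · simp [sphericalCoord, Real.cos_arccos hz.1 hz.2]

theorem hausdorffMeasure_sphere_lt_top : μH[2] (sphere (0 : Euc 3) 1) < ∞ := by
  set R : Set (ℝ × ℝ) := Icc 0 Real.pi ×ˢ Icc (-Real.pi) Real.pi
  have hR : IsCompact R := isCompact_Icc.prod isCompact_Icc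
  obtain ⟨C, hC⟩ := LocallyLipschitzOn.exists_lipschitzOnWith_of_compact hR
    (contDiff_sphericalCoord.locallyLipschitz.locallyLipschitzOn (s := R))
  refine (measure_mono sphere_subset_image_sphericalCoord).trans_lt
    ((hC.hausdorffMeasure_image_le zero_le_two).trans_lt ?_)
  exact ENNReal.mul_lt_top (by simp) hR.measure_lt_top

theorem sphHaar_three (A : Set (Euc 3)) :
    sphHaar 3 A = μH[2] (A ∩ sphere 0 1) / μH[2] (sphere (0 : Euc 3) 1) := by
  rw [sphHaar, show ((3 : ℕ) : ℝ) - 1 = 2 by norm_num]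

theorem sectionVol_three (K : Set (Euc 3)) (θ : Euc 3) :
    sectionVol 3 K θ = μH[2] (K ∩ {x : Euc 3 | ⟪x, θ⟫ = 0}) := by
  rw [sectionVol, show ((3 : ℕ) : ℝ) - 1 = 2 by norm_num]

/-- The unit ball truncated by three symmetric slabs with normals `u i`. -/
def truncatedBall (u : Fin 3 → Euc 3) : Set (Euc 3) :=
  {x | ‖x‖ ≤ 1 ∧ ∀ i, |⟪x, u i⟫| ≤ 4 / 5}

section truncatedBall

variable {u : Fin 3 → Euc 3}

theorem truncatedBall_eq_inter :
    truncatedBall u = closedBall 0 1 ∩ ⋂ i, {x : Euc 3 | |⟪x, u i⟫| ≤ 4 / 5} := by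
  ext x
  simp [truncatedBall]

theorem convex_truncatedBall : Convex ℝ (truncatedBall u) := by
  rw [truncatedBall_eq_inter]
  refine (convex_closedBall 0 1).inter (convex_iInter fun i => ?_)
  have h : {x : Euc 3 | |⟪x, u i⟫| ≤ 4 / 5} = innerSL ℝ (u i) ⁻¹' Icc (-(4 / 5)) (4 / 5) := by
    ext x
    simp [abs_le, real_inner_comm]
  rw [h]
  exact (convex_Icc _ _).linear_preimage (innerSL ℝ (u i)).toLinearMap

theorem isClosed_truncatedBall : IsClosed (truncatedBall u) := by
  rw [truncatedBall_eq_inter]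
  exact isClosed_closedBall.inter
    (isClosed_iInter fun i => isClosed_le (by fun_prop) continuous_const)

theorem isCompact_truncatedBall : IsCompact (truncatedBall u) :=
  (isCompact_closedBall (0 : Euc 3) 1).of_isClosed_subset isClosed_truncatedBall
    fun _ hx => mem_closedBall_zero_iff.2 hx.1

theorem zero_mem_interior_truncatedBall : (0 : Euc 3) ∈ interior (truncatedBall u) := by
  rw [mem_interior]
  refine ⟨ball 0 1 ∩ ⋂ i, {x : Euc 3 | |⟪x, u i⟫| < 4 / 5}, ?_, ?_, ?_⟩
  · rw [truncatedBall_eq_inter]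
    exact inter_subset_inter ball_subset_closedBall
      (iInter_mono fun i x (hx : |⟪x, u i⟫| < 4 / 5) => hx.le)
  · exact isOpen_ball.inter
      (isOpen_iInter_of_finite fun i => isOpen_lt (by fun_prop) continuous_const)
  · simp

theorem isConvexBody_truncatedBall : IsConvexBody (truncatedBall u) :=
  ⟨convex_truncatedBall, isCompact_truncatedBall, 0, zero_mem_interior_truncatedBall⟩

theorem truncatedBall_eq_neg : truncatedBall u = -truncatedBall u := by
  ext x
  simp [truncatedBall]

theorem le_radial_truncatedBall_iff {θ : Euc 3} (hθ : ‖θ‖ = 1) {t : ℝ} (ht : 0 ≤ t) :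
    t ≤ radial (truncatedBall u) θ ↔ t ≤ 1 ∧ ∀ i, t * |⟪θ, u i⟫| ≤ 4 / 5 := by
  have key : ∀ a : ℝ, 0 ≤ a →
      (a • θ ∈ truncatedBall u ↔ a ≤ 1 ∧ ∀ i, a * |⟪θ, u i⟫| ≤ 4 / 5) := by
    intro a ha
    simp [truncatedBall, norm_smul, hθ, real_inner_smul_left, abs_mul, abs_of_nonneg ha]
  rw [← key t ht]
  set T := {a : ℝ | 0 ≤ a ∧ a • θ ∈ truncatedBall u} with hT
  have hbdd : BddAbove T := ⟨1, fun a ha => ((key a ha.1).1 ha.2).1⟩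
  have hne : T.Nonempty := ⟨0, le_rfl, (key 0 le_rfl).2 (by norm_num)⟩
  have hclosed : IsClosed T :=
    isClosed_Ici.inter (isClosed_truncatedBall.preimage (by fun_prop))
  constructor
  · intro h
    have hmem : sSup T ∈ T := hclosed.csSup_mem hne hbdd
    obtain ⟨h1, h2⟩ := (key _ hmem.1).1 hmem.2
    exact (key t ht).2 ⟨h.trans h1, fun i =>
      (mul_le_mul_of_nonneg_right h (abs_nonneg _)).trans (h2 i)⟩
  · intro h
    exact le_csSup hbdd ⟨ht, h⟩

end truncatedBall

/-- The pair of open polar caps around `±u` on the unit sphere. -/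
def capPair (t : ℝ) (u : Euc 3) : Set (Euc 3) :=
  {θ | 4 / 5 < t * |⟪θ, u⟫|} ∩ sphere 0 1

theorem measurableSet_capPair (t : ℝ) (u : Euc 3) : MeasurableSet (capPair t u) :=
  ((isOpen_lt continuous_const (by fun_prop)).measurableSet).inter isClosed_sphere.measurableSet

theorem hausdorffMeasure_capPair_eq (t : ℝ) {u v : Euc 3} (h : ‖u‖ = ‖v‖) :
    μH[2] (capPair t u) = μH[2] (capPair t v) := by
  set e : Euc 3 ≃ₗᵢ[ℝ] Euc 3 := (ℝ ∙ (u - v))ᗮ.reflection with he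
  have huv : e u = v := Submodule.reflection_sub h
  have : e ⁻¹' capPair t v = capPair t u := by
    ext θ
    simp only [capPair, ← huv, mem_preimage, mem_inter_iff, mem_ofPred_eq,
      mem_sphere_zero_iff_norm, LinearIsometryEquiv.inner_map_map, LinearIsometryEquiv.norm_map]
  rw [← this]
  exact e.toIsometryEquiv.hausdorffMeasure_preimage 2 _

theorem disjoint_capPair {t : ℝ} (ht : t ≤ 1) {u v : Euc 3} (hu : ‖u‖ = 1)
    (hv : ‖v‖ = 1) (huv : |⟪u, v⟫| ≤ 7 / 25) : Disjoint (capPair t u) (capPair t v) := by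
  rw [Set.disjoint_left]
  rintro θ ⟨h1, hθ⟩ ⟨h2, -⟩
  rw [mem_sphere_zero_iff_norm] at hθ
  simp only [mem_ofPred_eq] at h1 h2
  have h1' : 4 / 5 < |⟪θ, u⟫| := h1.trans_le (mul_le_of_le_one_left (abs_nonneg _) ht)
  have h2' : 4 / 5 < |⟪θ, v⟫| := h2.trans_le (mul_le_of_le_one_left (abs_nonneg _) ht)
  have hplus : ‖u + v‖ ^ 2 ≤ (8 / 5) ^ 2 := by
    rw [norm_add_sq_real, hu, hv]
    linarith [(abs_le.1 huv).2]
  have hminus : ‖u - v‖ ^ 2 ≤ (8 / 5) ^ 2 := by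
    rw [norm_sub_sq_real, hu, hv]
    linarith [(abs_le.1 huv).1]
  have hplus' := abs_le_of_sq_le_sq' hplus (by norm_num)
  have hminus' := abs_le_of_sq_le_sq' hminus (by norm_num)
  have hp := abs_le.1 (abs_real_inner_le_norm θ (u + v))
  have hm := abs_le.1 (abs_real_inner_le_norm θ (u - v))
  rw [hθ, one_mul, inner_add_right] at hp
  rw [hθ, one_mul, inner_sub_right] at hm
  rcases lt_abs.1 h1' with h1 | h1 <;> rcases lt_abs.1 h2' with h2 | h2 <;> linarith

theorem sphHaar_le_radial_truncatedBall {u : Fin 3 → Euc 3} (hu : ∀ i, ‖u i‖ = 1)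
    (huu : Pairwise fun i j => |⟪u i, u j⟫| ≤ 7 / 25) {t : ℝ} (ht : 0 ≤ t) :
    sphHaar 3 {θ | t ≤ radial (truncatedBall u) θ} =
      if t ≤ 1 then
        (μH[2] (sphere (0 : Euc 3) 1) - 3 * μH[2] (capPair t (EuclideanSpace.single 0 1))) /
          μH[2] (sphere (0 : Euc 3) 1)
      else 0 := by
  rw [sphHaar_three]
  split_ifs with h1
  · congr 1
    have : {θ | t ≤ radial (truncatedBall u) θ} ∩ sphere 0 1 =
        sphere (0 : Euc 3) 1 \ ⋃ i, capPair t (u i) := by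
      ext θ
      by_cases hθ : ‖θ‖ = 1
      · simp [hθ, le_radial_truncatedBall_iff hθ ht, h1, capPair]
      · simp [hθ]
    have hsub : ⋃ i, capPair t (u i) ⊆ sphere (0 : Euc 3) 1 :=
      iUnion_subset fun i => inter_subset_right
    rw [this, measure_sdiff hsub
      (MeasurableSet.iUnion fun i => measurableSet_capPair t (u i)).nullMeasurableSet
      ((measure_mono hsub).trans_lt hausdorffMeasure_sphere_lt_top).ne,
      measure_iUnion (fun i j hij => disjoint_capPair h1 (hu i) (hu j) (huu hij))
      (fun i => measurableSet_capPair t (u i)), tsum_fintype]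
    congr 1
    rw [Finset.sum_congr rfl fun i _ => hausdorffMeasure_capPair_eq t
      (show ‖u i‖ = ‖(EuclideanSpace.single 0 1 : Euc 3)‖ by simp [hu i])]
    simp
  · have : {θ | t ≤ radial (truncatedBall u) θ} ∩ sphere (0 : Euc 3) 1 = ∅ := by
      ext θ
      simp only [mem_inter_iff, mem_ofPred_eq, mem_sphere_zero_iff_norm, mem_empty_iff_false,
        iff_false, not_and]
      intro h hθ
      exact h1 ((le_radial_truncatedBall_iff hθ ht).1 h).1
    simp [this]

/-! ### Central sections -/

theorem exists_linearIsometry_range_eq {θ : Euc 3} (hθ : ‖θ‖ = 1) :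
    ∃ φ : Euc 2 →ₗᵢ[ℝ] Euc 3, range φ = {x | ⟪x, θ⟫ = 0} := by
  have : Fact (Module.finrank ℝ (Euc 3) = 2 + 1) := ⟨by simp⟩
  have hθ0 : θ ≠ 0 := by rintro rfl; simp at hθ
  let b := OrthonormalBasis.fromOrthogonalSpanSingleton (𝕜 := ℝ) 2 hθ0
  refine ⟨(ℝ ∙ θ)ᗮ.subtypeₗᵢ.comp b.repr.symm.toLinearIsometry, ?_⟩
  ext x
  rw [mem_ofPred_eq, ← Submodule.mem_orthogonal_singleton_iff_inner_left]
  constructor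
  · rintro ⟨y, rfl⟩
    exact (b.repr.symm y).2
  · intro hx
    exact ⟨b.repr ⟨x, hx⟩, by simp⟩

theorem sectionVol_eq_hausdorffMeasure_preimage {θ : Euc 3} {φ : Euc 2 →ₗᵢ[ℝ] Euc 3}
    (hφ : range φ = {x | ⟪x, θ⟫ = 0}) (K : Set (Euc 3)) :
    sectionVol 3 K θ = μH[2] (φ ⁻¹' K) := by
  rw [sectionVol_three, ← hφ, φ.isometry.hausdorffMeasure_preimage (Or.inl zero_le_two)]

/-- The area of the unit disc. -/
def discArea : ℝ≥0∞ := μH[2] (closedBall (0 : Euc 2) 1)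

theorem discArea_lt_top : discArea < ∞ := (isCompact_closedBall (0 : Euc 2) 1).measure_lt_top

theorem sectionVol_truncatedBall_eq {u : Fin 3 → Euc 3} (hu : ∀ i, ‖u i‖ = 1) {θ : Euc 3}
    (hθ : ‖θ‖ = 1) (h : ∀ i, 3 / 5 ≤ |⟪u i, θ⟫|) :
    sectionVol 3 (truncatedBall u) θ = discArea := by
  obtain ⟨φ, hφ⟩ := exists_linearIsometry_range_eq hθ
  rw [sectionVol_eq_hausdorffMeasure_preimage hφ, discArea]
  congr 1
  ext y
  have hy : ⟪φ y, θ⟫ = 0 := hφ.subset (mem_range_self y)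
  simp only [truncatedBall, mem_preimage, mem_ofPred_eq, LinearIsometry.norm_map,
    mem_closedBall_zero_iff, and_iff_left_iff_imp]
  intro hy1 i
  have hproj : ⟪φ y, u i⟫ = ⟪φ y, u i - ⟪u i, θ⟫ • θ⟫ := by
    rw [inner_sub_right, inner_smul_right, hy]; ring
  have hnorm : ‖u i - ⟪u i, θ⟫ • θ‖ ≤ 4 / 5 := by
    refine abs_le_of_sq_le_sq' ?_ (by norm_num) |>.2
    rw [norm_sub_sq_real, inner_smul_right, norm_smul, hθ, hu i, Real.norm_eq_abs, mul_one,
      sq_abs]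
    have := (sq_le_sq₀ (by norm_num) (abs_nonneg _)).2 (h i)
    rw [sq_abs] at this
    nlinarith
  rw [hproj]
  refine (abs_real_inner_le_norm _ _).trans ?_
  rw [LinearIsometry.norm_map]
  nlinarith [norm_nonneg y]

theorem sectionVol_truncatedBall_lt {u : Fin 3 → Euc 3} (hu : ∀ i, ‖u i‖ = 1) {θ : Euc 3}
    (hθ : ‖θ‖ = 1) {i : Fin 3} (h : ⟪u i, θ⟫ ^ 2 ≤ 1 / 3) :
    sectionVol 3 (truncatedBall u) θ < discArea := by
  obtain ⟨φ, hφ⟩ := exists_linearIsometry_range_eq hθ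
  rw [sectionVol_eq_hausdorffMeasure_preimage hφ, discArea]
  set V : Set (Euc 2) := {y | ‖y‖ < 1 ∧ 4 / 5 < ⟪φ y, u i⟫} with hV
  have hVopen : IsOpen V := by
    have hcont : Continuous fun y => ⟪φ y, u i⟫ := φ.continuous.inner continuous_const
    exact (isOpen_lt continuous_norm continuous_const).inter (isOpen_lt continuous_const hcont)
  have hVne : V.Nonempty := by
    set p : Euc 3 := u i - ⟪u i, θ⟫ • θ with hp
    set m : ℝ := 1 - ⟪u i, θ⟫ ^ 2 with hm
    have hpθ : ⟪p, θ⟫ = 0 := by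
      rw [hp, inner_sub_left, inner_smul_left, real_inner_self_eq_norm_sq, hθ]; simp
    have hpu : ⟪p, u i⟫ = m := by
      rw [hp, inner_sub_left, inner_smul_left, real_inner_self_eq_norm_sq, hu i,
        real_inner_comm (u i) θ]
      simp; ring
    have hpn : ‖p‖ ^ 2 = m := by
      rw [← real_inner_self_eq_norm_sq]
      nth_rewrite 2 [hp]
      rw [inner_sub_right, inner_smul_right, hpθ, hpu]; ring
    obtain ⟨y, hy⟩ : p ∈ range φ := hφ.symm.subset hpθ
    have hm0 : 2 / 3 ≤ m := by linarith
    have hppos : 0 < ‖p‖ := by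
      by_contra hcon
      have : ‖p‖ = 0 := le_antisymm (not_lt.1 hcon) (norm_nonneg p)
      rw [this] at hpn; norm_num at hpn; linarith
    have hp45 : 0.81 < ‖p‖ := lt_of_pow_lt_pow_left₀ 2 hppos.le (by rw [hpn]; linarith)
    have hyn : ‖y‖ = ‖p‖ := by rw [← hy, LinearIsometry.norm_map]
    refine ⟨(0.99 / ‖p‖) • y, ?_, ?_⟩
    · rw [norm_smul, hyn, Real.norm_of_nonneg (by positivity), div_mul_cancel₀ _ hppos.ne']
      norm_num
    · rw [map_smul, hy, inner_smul_left, hpu, ← hpn]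
      simp only [conj_trivial]
      have : 0.99 / ‖p‖ * ‖p‖ ^ 2 = 0.99 * ‖p‖ := by field_simp
      rw [this]
      linarith
  have hVsub : V ⊆ closedBall 0 1 := fun y hy => mem_closedBall_zero_iff.2 hy.1.le
  have hsub : φ ⁻¹' truncatedBall u ⊆ closedBall 0 1 \ V := by
    rintro y ⟨hy1, hy2⟩
    refine ⟨mem_closedBall_zero_iff.2 (by simpa using hy1), fun hy => ?_⟩
    exact absurd ((le_abs_self _).trans (hy2 i)) (not_le.2 hy.2)
  refine (measure_mono hsub).trans_lt ?_
  rw [measure_sdiff hVsub hVopen.measurableSet.nullMeasurableSet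
    ((measure_mono hVsub).trans_lt discArea_lt_top).ne]
  exact ENNReal.sub_lt_self discArea_lt_top.ne
    ((hVopen.measure_pos _ hVne).trans_le (measure_mono hVsub)).ne'
    (hVopen.measure_pos _ hVne).ne'

/-! ### The two bodies -/

/-- Three mutually orthogonal directions. -/
def orthogonalDirections : Fin 3 → Euc 3 := ![!₂[1, 0, 0], !₂[0, 1, 0], !₂[0, 0, 1]]

/-- Three directions, one of which is slightly tilted towards another. -/
def tiltedDirections : Fin 3 → Euc 3 := ![!₂[1, 0, 0], !₂[0, 1, 0], !₂[7 / 25, 0, 24 / 25]]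

theorem norm_orthogonalDirections (i : Fin 3) : ‖orthogonalDirections i‖ = 1 := by
  fin_cases i <;> simp [orthogonalDirections, EuclideanSpace.norm_eq, Fin.sum_univ_three]

theorem norm_tiltedDirections (i : Fin 3) : ‖tiltedDirections i‖ = 1 := by
  fin_cases i <;> simp [tiltedDirections, EuclideanSpace.norm_eq, Fin.sum_univ_three]
  norm_num

theorem abs_inner_orthogonalDirections_le :
    Pairwise fun i j => |⟪orthogonalDirections i, orthogonalDirections j⟫| ≤ 7 / 25 := by
  intro i j hij
  fin_cases i <;> fin_cases j <;>
    simp [orthogonalDirections, PiLp.inner_apply, Fin.sum_univ_three] at hij ⊢ <;> norm_num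

theorem abs_inner_tiltedDirections_le :
    Pairwise fun i j => |⟪tiltedDirections i, tiltedDirections j⟫| ≤ 7 / 25 := by
  intro i j hij
  fin_cases i <;> fin_cases j <;>
    simp [tiltedDirections, PiLp.inner_apply, Fin.sum_univ_three] at hij ⊢ <;> norm_num [abs_le]

theorem Sdist_orthogonal_eq_zero :
    Sdist 3 (truncatedBall orthogonalDirections) discArea.toReal = 0 := by
  rw [Sdist, sphHaar_three, ENNReal.ofReal_toReal discArea_lt_top.ne]
  have : {θ | discArea ≤ sectionVol 3 (truncatedBall orthogonalDirections) θ} ∩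
      sphere (0 : Euc 3) 1 = ∅ := by
    rw [eq_empty_iff_forall_notMem]
    rintro θ ⟨h, hθ⟩
    rw [mem_sphere_zero_iff_norm] at hθ
    have hs := sum_sq_of_mem_sphere hθ
    obtain ⟨i, hi⟩ : ∃ i, ⟪orthogonalDirections i, θ⟫ ^ 2 ≤ 1 / 3 := by
      by_contra! hcon
      have h0 := hcon 0
      have h1 := hcon 1
      have h2 := hcon 2
      simp [orthogonalDirections, PiLp.inner_apply, Fin.sum_univ_three] at h0 h1 h2
      linarith
    exact absurd h (not_le.2 (sectionVol_truncatedBall_lt norm_orthogonalDirections hθ hi))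
  simp [this]

theorem Sdist_tilted_ne_zero :
    Sdist 3 (truncatedBall tiltedDirections) discArea.toReal ≠ 0 := by
  rw [Sdist, sphHaar_three, ENNReal.ofReal_toReal discArea_lt_top.ne]
  refine ENNReal.div_ne_zero.2 ⟨?_, hausdorffMeasure_sphere_lt_top.ne⟩
  set A := {θ | discArea ≤ sectionVol 3 (truncatedBall tiltedDirections) θ} ∩
    sphere (0 : Euc 3) 1 with hA
  set P : Euc 3 → ℝ × ℝ := fun x => (x 0, x 1) with hP
  have hPlip : LipschitzWith 1 P := by
    refine LipschitzWith.of_dist_le_mul fun x y => ?_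
    rw [NNReal.coe_one, one_mul, Prod.dist_eq, dist_eq_norm x y]
    exact max_le (PiLp.norm_apply_le (x - y) 0) (PiLp.norm_apply_le (x - y) 1)
  set U : Set (ℝ × ℝ) := Ioo 0.6 0.62 ×ˢ Ioo 0.6 0.62 with hU
  have hUopen : IsOpen U := isOpen_Ioo.prod isOpen_Ioo
  have hUne : U.Nonempty := ⟨(0.61, 0.61), by norm_num [hU]⟩
  have hsub : U ⊆ P '' A := by
    rintro ⟨x, y⟩ ⟨⟨hx1, hx2⟩, hy1, hy2⟩
    simp only at hx1 hx2 hy1 hy2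
    set z := Real.sqrt (1 - x ^ 2 - y ^ 2) with hz
    have hz2 : z ^ 2 = 1 - x ^ 2 - y ^ 2 := Real.sq_sqrt (by nlinarith)
    have hz1 : 0.48 ≤ z := Real.le_sqrt_of_sq_le (by nlinarith)
    have hθ : ‖(!₂[x, y, z] : Euc 3)‖ = 1 := by
      rw [EuclideanSpace.norm_eq, Fin.sum_univ_three]
      simp [hz2]
    refine ⟨!₂[x, y, z], ⟨?_, mem_sphere_zero_iff_norm.2 hθ⟩, by simp [hP]⟩
    refine (sectionVol_truncatedBall_eq norm_tiltedDirections hθ fun i => ?_).ge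
    refine le_trans ?_ (le_abs_self _)
    fin_cases i <;> simp [tiltedDirections, PiLp.inner_apply, Fin.sum_univ_three] <;> linarith
  have hpos : 0 < μH[2] (P '' A) := (hUopen.measure_pos _ hUne).trans_le (measure_mono hsub)
  have hle := hPlip.hausdorffMeasure_image_le (d := 2) zero_le_two A
  simp only [ENNReal.coe_one, ENNReal.one_rpow, one_mul] at hle
  exact (hpos.trans_le hle).ne'

/-- There exist origin-symmetric convex bodies `K, L` in `ℝ³` containing the
origin in their interiors whose radial functions have the same distribution, but whose
distribution functions of areas of central sections differ somewhere. -/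
theorem stmt_4 : ∃ K L : Set (Euc 3),
    IsConvexBody K ∧ IsConvexBody L ∧ K = -K ∧ L = -L ∧
    (0 : Euc 3) ∈ interior K ∧ (0 : Euc 3) ∈ interior L ∧
    (∀ t : ℝ, 0 ≤ t →
      sphHaar 3 {θ : Euc 3 | t ≤ radial K θ} =
      sphHaar 3 {θ : Euc 3 | t ≤ radial L θ}) ∧
    (∃ t₀ : ℝ, 0 ≤ t₀ ∧ Sdist 3 K t₀ ≠ Sdist 3 L t₀) := by
  refine ⟨truncatedBall orthogonalDirections, truncatedBall tiltedDirections,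
    isConvexBody_truncatedBall, isConvexBody_truncatedBall, truncatedBall_eq_neg,
    truncatedBall_eq_neg, zero_mem_interior_truncatedBall, zero_mem_interior_truncatedBall,
    fun t ht => ?_, discArea.toReal, ENNReal.toReal_nonneg, ?_⟩
  · rw [sphHaar_le_radial_truncatedBall norm_orthogonalDirections
        abs_inner_orthogonalDirections_le ht,
      sphHaar_le_radial_truncatedBall norm_tiltedDirections abs_inner_tiltedDirections_le ht]
  · rw [Sdist_orthogonal_eq_zero]
    exact Sdist_tilted_ne_zero.symm
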